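/- Lower bound for single-linkage on cs-ratio_AV: there exists a constant c > 0 such that for every n ≥ 4 and every k with 2 < k ≤ n/2, there is a finite metric space of n points (a subset of the real line with the absolute-value metric) for which some execution of single-linkage produces a k-clustering C with cs-ratio_AV(C) ≥ c · (n − k). -/

import Mathlib

open Finset

/-- Average distance between two finite sets of points. -/
noncomputable def avgD {X : Type*} (d : X → X → ℝ) (A B : Finset X) : ℝ :=
  (∑ a ∈ A, ∑ b ∈ B, d a b) / ((A.card : ℝ) * (B.card : ℝ))

/-- Average pairwise distance within a finite set (sum over unordered pairs divided by
`C(|A|,2)`; for symmetric `d` this equals the sum over `A.offDiag` divided by `2·C(|A|,2)`). -/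
noncomputable def avgS {X : Type*} [DecidableEq X] (d : X → X → ℝ) (A : Finset X) : ℝ :=
  (∑ p ∈ A.offDiag, d p.1 p.2) / (2 * (A.card.choose 2 : ℝ))

/-- `sep_min(𝒞) = min_{A ≠ B ∈ 𝒞} avg(A,B)`. -/
noncomputable def sepMin {X : Type*} (d : X → X → ℝ) (𝒞 : Finset (Finset X)) : ℝ :=
  sInf {r : ℝ | ∃ A ∈ 𝒞, ∃ B ∈ 𝒞, A ≠ B ∧ r = avgD d A B}

/-- `max-avg(𝒞) = max {avg(C) : C ∈ 𝒞, |C| ≥ 2}` (and `0` if all clusters are singletons,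
since `sSup ∅ = 0` in `ℝ`). -/
noncomputable def maxAvg {X : Type*} [DecidableEq X] (d : X → X → ℝ)
    (𝒞 : Finset (Finset X)) : ℝ :=
  sSup {r : ℝ | ∃ C ∈ 𝒞, 2 ≤ C.card ∧ r = avgS d C}

/-- Single-linkage distance between two clusters: `min {d a b : a ∈ A, b ∈ B}`. -/
noncomputable def minDistF {X : Type*} (d : X → X → ℝ) (A B : Finset X) : ℝ :=
  sInf {r : ℝ | ∃ a ∈ A, ∃ b ∈ B, r = d a b}

/-- An execution of single-linkage: `part n` is the partition into `n` singletons and,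
for `1 ≤ k < n`, `part k` is obtained from `part (k+1)` by merging two distinct clusters
minimizing the single-linkage distance. -/
structure SingleLinkExec (X : Type*) [Fintype X] [DecidableEq X] (d : X → X → ℝ) where
  part : ℕ → Finset (Finset X)
  init : part (Fintype.card X) = Finset.univ.image (fun x : X => ({x} : Finset X))
  merge : ∀ k : ℕ, 1 ≤ k → k < Fintype.card X →
    ∃ A ∈ part (k + 1), ∃ B ∈ part (k + 1), A ≠ B ∧
      (∀ A' ∈ part (k + 1), ∀ B' ∈ part (k + 1), A' ≠ B' →
        minDistF d A B ≤ minDistF d A' B') ∧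
      part k = insert (A ∪ B) (((part (k + 1)).erase A).erase B)

lemma minDistF_le {X : Type*} {d : X → X → ℝ} (hd : ∀ x y, 0 ≤ d x y) {A B : Finset X}
    {a b : X} (ha : a ∈ A) (hb : b ∈ B) : minDistF d A B ≤ d a b := by
  refine csInf_le ⟨0, ?_⟩ ⟨a, ha, b, hb, rfl⟩
  rintro _ ⟨a, -, b, -, rfl⟩
  exact hd a b

lemma le_maxAvg {X : Type*} [DecidableEq X] {d : X → X → ℝ} {𝒞 : Finset (Finset X)} {C : Finset X}
    (hC : C ∈ 𝒞) (hcard : 2 ≤ C.card) :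
    avgS d C ≤ maxAvg d 𝒞 := by
  refine le_csSup ?_ ⟨C, hC, hcard, rfl⟩
  refine ((𝒞.image (avgS d)).finite_toSet.subset ?_).bddAbove
  rintro _ ⟨C, hC, -, rfl⟩
  exact mem_coe.2 (mem_image_of_mem _ hC)

lemma one_le_abs_natCast_sub {i j : ℕ} (h : i ≠ j) : (1 : ℝ) ≤ |(i : ℝ) - j| := by
  have h' : (1 : ℤ) ≤ |(i : ℤ) - j| := Int.one_le_abs (by omega)
  exact_mod_cast h'

lemma sum_range_abs_sub (m : ℕ) :
    ∑ i ∈ range m, ∑ j ∈ range m, |(i : ℝ) - j| = m * (m ^ 2 - 1) / 3 := by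
  have key : ∀ m : ℕ, ∑ i ∈ range m, |(i : ℝ) - m| = m * (m + 1) / 2 := by
    intro m
    have h1 : ∑ i ∈ range m, |(i : ℝ) - m| = ∑ i ∈ range m, ((i : ℝ) + 1) := by
      rw [← sum_range_reflect (fun i : ℕ => (i : ℝ) + 1)]
      refine sum_congr rfl fun i hi => ?_
      have him := mem_range.1 hi
      have : (i : ℝ) < m := by exact_mod_cast him
      rw [abs_of_neg (by linarith), Nat.sub_sub, Nat.cast_sub (by omega)]
      push_cast
      ring
    rw [h1]
    clear h1
    induction m with
    | zero => simp
    | succ m ih => rw [sum_range_succ, ih]; push_cast; ring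
  induction m with
  | zero => simp
  | succ m ih =>
    have h2 : ∑ j ∈ range m, |(m : ℝ) - j| = m * (m + 1) / 2 := by
      rw [← key m]
      exact sum_congr rfl fun j _ => abs_sub_comm _ _
    simp only [sum_range_succ, sum_add_distrib, ih, key, h2]
    push_cast
    simp
    ring

section Chain

variable {X : Type*} [Fintype X]

/-- The points whose position is less than `t`. -/
def initialSegment (p : X → ℕ) (t : ℕ) : Finset X := univ.filter fun x => p x < t

lemma mem_initialSegment {p : X → ℕ} {t : ℕ} {x : X} : x ∈ initialSegment p t ↔ p x < t := by
  simp [initialSegment]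

lemma image_initialSegment {p : X → ℕ} {t : ℕ} (hsurj : ∀ i < t, ∃ x, p x = i) :
    (initialSegment p t).image p = range t := by
  ext i
  simp only [mem_image, mem_initialSegment, mem_range]
  constructor
  · rintro ⟨x, hx, rfl⟩
    exact hx
  · intro hi
    obtain ⟨x, rfl⟩ := hsurj i hi
    exact ⟨x, hi, rfl⟩

lemma card_initialSegment {p : X → ℕ} (hp : Function.Injective p) {t : ℕ}
    (hsurj : ∀ i < t, ∃ x, p x = i) :
    (initialSegment p t).card = t := by
  rw [← card_image_of_injective _ hp, image_initialSegment hsurj, card_range]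

variable [DecidableEq X]

/-- The clustering consisting of the initial segment of length `t` and singletons elsewhere. -/
def segmentClustering (p : X → ℕ) (t : ℕ) : Finset (Finset X) :=
  insert (initialSegment p t) ((univ.filter fun x => t ≤ p x).image fun x => {x})

lemma mem_segmentClustering {p : X → ℕ} {t : ℕ} {C : Finset X} :
    C ∈ segmentClustering p t ↔ C = initialSegment p t ∨ ∃ x, t ≤ p x ∧ C = {x} := by
  simp [segmentClustering, eq_comm]

lemma ne_of_mem_segmentClustering {p : X → ℕ} {t : ℕ} {A B : Finset X}
    (hA : A ∈ segmentClustering p t) (hB : B ∈ segmentClustering p t) (hAB : A ≠ B)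
    {a b : X} (ha : a ∈ A) (hb : b ∈ B) : a ≠ b := by
  rintro rfl
  rw [mem_segmentClustering] at hA hB
  rcases hA with rfl | ⟨x, hx, rfl⟩ <;> rcases hB with rfl | ⟨y, hy, rfl⟩
  · exact hAB rfl
  · rw [mem_initialSegment] at ha
    rw [mem_singleton] at hb
    subst hb
    omega
  · rw [mem_initialSegment] at hb
    rw [mem_singleton] at ha
    subst ha
    omega
  · rw [mem_singleton] at ha hb
    exact hAB (by rw [← ha, ← hb])

lemma nonempty_of_mem_segmentClustering {p : X → ℕ} {t : ℕ} {o : X} (ho : p o < t)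
    {A : Finset X} (hA : A ∈ segmentClustering p t) : A.Nonempty := by
  rcases mem_segmentClustering.1 hA with rfl | ⟨x, -, rfl⟩
  · exact ⟨o, mem_initialSegment.2 ho⟩
  · exact singleton_nonempty x

lemma segmentClustering_one {p : X → ℕ} (hp : Function.Injective p) {o : X} (ho : p o = 0) :
    segmentClustering p 1 = univ.image fun x : X => ({x} : Finset X) := by
  have hseg : initialSegment p 1 = {o} := by
    ext x
    rw [mem_initialSegment, mem_singleton, ← hp.eq_iff]
    omega
  ext C
  rw [mem_segmentClustering, hseg]
  constructor
  · rintro (rfl | ⟨x, -, rfl⟩) <;> simp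
  · intro h
    obtain ⟨x, -, rfl⟩ := mem_image.1 h
    by_cases hx : x = o
    · exact Or.inl (by rw [hx])
    · refine Or.inr ⟨x, ?_, rfl⟩
      have : p x ≠ p o := fun h => hx (hp h)
      omega

lemma segmentClustering_succ {p : X → ℕ} (hp : Function.Injective p) {y : X}
    {t : ℕ} (hy : p y = t) :
    segmentClustering p (t + 1) =
      insert (initialSegment p t ∪ {y})
        (((segmentClustering p t).erase (initialSegment p t)).erase {y}) := by
  have hseg : initialSegment p (t + 1) = initialSegment p t ∪ {y} := by
    ext x
    rw [mem_union, mem_initialSegment, mem_initialSegment, mem_singleton, ← hp.eq_iff]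
    omega
  ext C
  rw [mem_segmentClustering, mem_insert, mem_erase, mem_erase, mem_segmentClustering, hseg]
  refine or_congr Iff.rfl ⟨?_, ?_⟩
  · rintro ⟨x, hx, rfl⟩
    refine ⟨?_, ?_, Or.inr ⟨x, by omega, rfl⟩⟩
    · intro h
      rw [singleton_inj] at h
      subst h
      omega
    · intro h
      have := mem_initialSegment.1 (h ▸ mem_singleton_self x)
      omega
  · rintro ⟨h1, h2, h | ⟨x, hx, rfl⟩⟩
    · exact absurd h h2
    · refine ⟨x, ?_, rfl⟩
      have : p x ≠ p y := fun h => h1 (by rw [hp h])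
      omega

variable {p : X → ℕ} {d : X → X → ℝ}

lemma one_le_minDistF_of_mem_segmentClustering (hp : Function.Injective p)
    (hd : ∀ x y, d x y = |(p x : ℝ) - p y|) {t : ℕ} {o : X} (ho : p o < t) {A B : Finset X}
    (hA : A ∈ segmentClustering p t) (hB : B ∈ segmentClustering p t) (hAB : A ≠ B) :
    1 ≤ minDistF d A B := by
  obtain ⟨a, ha⟩ := nonempty_of_mem_segmentClustering ho hA
  obtain ⟨b, hb⟩ := nonempty_of_mem_segmentClustering ho hB
  refine le_csInf ⟨_, a, ha, b, hb, rfl⟩ ?_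
  rintro _ ⟨a, ha, b, hb, rfl⟩
  rw [hd]
  exact one_le_abs_natCast_sub (hp.ne (ne_of_mem_segmentClustering hA hB hAB ha hb))

lemma one_le_avgD_of_mem_segmentClustering (hp : Function.Injective p)
    (hd : ∀ x y, d x y = |(p x : ℝ) - p y|) {t : ℕ} {o : X} (ho : p o < t) {A B : Finset X}
    (hA : A ∈ segmentClustering p t) (hB : B ∈ segmentClustering p t) (hAB : A ≠ B) :
    1 ≤ avgD d A B := by
  have hA0 : (0 : ℝ) < A.card := by
    exact_mod_cast (nonempty_of_mem_segmentClustering ho hA).card_pos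
  have hB0 : (0 : ℝ) < B.card := by
    exact_mod_cast (nonempty_of_mem_segmentClustering ho hB).card_pos
  rw [avgD, one_le_div (mul_pos hA0 hB0)]
  calc (A.card : ℝ) * B.card = ∑ a ∈ A, ∑ b ∈ B, (1 : ℝ) := by simp
    _ ≤ ∑ a ∈ A, ∑ b ∈ B, d a b := by
      refine sum_le_sum fun a ha => sum_le_sum fun b hb => ?_
      rw [hd]
      exact one_le_abs_natCast_sub (hp.ne (ne_of_mem_segmentClustering hA hB hAB ha hb))

lemma sepMin_segmentClustering (hp : Function.Injective p)
    (hd : ∀ x y, d x y = |(p x : ℝ) - p y|) {t : ℕ} {o y z : X} (ho : p o < t)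
    (hy : p y = t) (hz : p z = t + 1) : sepMin d (segmentClustering p t) = 1 := by
  have hlower : ∀ r ∈ {r : ℝ | ∃ A ∈ segmentClustering p t, ∃ B ∈ segmentClustering p t,
      A ≠ B ∧ r = avgD d A B}, 1 ≤ r := by
    rintro _ ⟨A, hA, B, hB, hAB, rfl⟩
    exact one_le_avgD_of_mem_segmentClustering hp hd ho hA hB hAB
  have hmem : (1 : ℝ) ∈ {r : ℝ | ∃ A ∈ segmentClustering p t, ∃ B ∈ segmentClustering p t,
      A ≠ B ∧ r = avgD d A B} := by
    refine ⟨{y}, mem_segmentClustering.2 (Or.inr ⟨y, hy.ge, rfl⟩), {z},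
      mem_segmentClustering.2 (Or.inr ⟨z, by omega, rfl⟩), ?_, ?_⟩
    · intro h
      rw [singleton_inj] at h
      subst h
      omega
    · simp [avgD, hd, hy, hz]
  exact le_antisymm (csInf_le ⟨1, hlower⟩ hmem) (le_csInf ⟨1, hmem⟩ hlower)

lemma avgS_initialSegment (hp : Function.Injective p)
    (hd : ∀ x y, d x y = |(p x : ℝ) - p y|) {t : ℕ} (ht : 2 ≤ t)
    (hsurj : ∀ i < t, ∃ x, p x = i) : avgS d (initialSegment p t) = (t + 1) / 3 := by
  have hsum : ∑ q ∈ (initialSegment p t).offDiag, d q.1 q.2 = t * ((t : ℝ) ^ 2 - 1) / 3 := by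
    rw [← sum_range_abs_sub, ← image_initialSegment hsurj, sum_image hp.injOn]
    simp_rw [sum_image hp.injOn]
    rw [← sum_product' (f := fun x y => |(p x : ℝ) - p y|)]
    simp_rw [← hd]
    refine sum_subset ?_ ?_
    · intro q hq
      rw [mem_offDiag] at hq
      simp [hq]
    · intro q hq hq'
      rw [mem_product] at hq
      rw [mem_offDiag] at hq'
      have : q.1 = q.2 := by tauto
      simp [hd, this]
  have ht' : (2 : ℝ) ≤ t := by exact_mod_cast ht
  rw [avgS, hsum, card_initialSegment hp hsurj, Nat.cast_choose_two,
    div_eq_iff (by nlinarith)]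
  ring

/-- The execution on consecutive integer positions that always enlarges the initial segment. -/
def segmentExec (n : ℕ) (hcard : Fintype.card X = n) (hn : 0 < n) (hp : Function.Injective p)
    (hd : ∀ x y, d x y = |(p x : ℝ) - p y|) (hsurj : ∀ i < n, ∃ x, p x = i) :
    SingleLinkExec X d where
  part j := segmentClustering p (n + 1 - j)
  init := by
    obtain ⟨o, ho⟩ := hsurj 0 hn
    rw [hcard, Nat.add_sub_cancel_left, segmentClustering_one hp ho]
  merge k hk hkn := by
    rw [hcard] at hkn
    obtain ⟨t, rfl⟩ : ∃ t, n = k + t + 1 := ⟨n - k - 1, by omega⟩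
    have e1 : k + t + 1 + 1 - (k + 1) = t + 1 := by omega
    have e2 : k + t + 1 + 1 - k = t + 1 + 1 := by omega
    rw [e1, e2]
    obtain ⟨o, ho⟩ := hsurj t (by omega)
    obtain ⟨y, hy⟩ := hsurj (t + 1) (by omega)
    have hot : p o < t + 1 := by omega
    have hA : initialSegment p (t + 1) ∈ segmentClustering p (t + 1) :=
      mem_segmentClustering.2 (Or.inl rfl)
    have hB : {y} ∈ segmentClustering p (t + 1) :=
      mem_segmentClustering.2 (Or.inr ⟨y, hy.ge, rfl⟩)
    refine ⟨initialSegment p (t + 1), hA, {y}, hB, ?_, ?_, segmentClustering_succ hp hy⟩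
    · intro h
      have := mem_initialSegment.1 (h ▸ mem_singleton_self y)
      omega
    · intro A' hA' B' hB' hAB'
      refine le_trans ?_ (one_le_minDistF_of_mem_segmentClustering hp hd hot hA' hB' hAB')
      refine (minDistF_le (fun x y => hd x y ▸ abs_nonneg _) (mem_initialSegment.2 hot)
        (mem_singleton_self y)).trans ?_
      simp [hd, ho, hy]

end Chain

/-- Lower bound for single-linkage on `cs-ratio_AV`: there is a constant `c > 0` such that
for every `n ≥ 4` and every `k` with `2 < k ≤ n/2`, there is an `n`-point subset `S` of the
real line (with the absolute-value metric) on which some execution of single-linkage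
produces a `k`-clustering `C` with `cs-ratio_AV(C) ≥ c · (n − k)`. -/
theorem singleLink_csRatioAV_lower_bound :
    ∃ c : ℝ, 0 < c ∧ ∀ n : ℕ, 4 ≤ n → ∀ k : ℕ, 2 < k → 2 * k ≤ n →
      ∃ S : Finset ℝ, S.card = n ∧
        ∃ E : SingleLinkExec {x : ℝ // x ∈ S} dist,
          c * ((n : ℝ) - (k : ℝ))
            ≤ maxAvg dist (E.part k) / sepMin dist (E.part k) := by
  refine ⟨1 / 3, by norm_num, fun n hn k hk hkn => ?_⟩
  refine ⟨(range n).image (fun i : ℕ => (i : ℝ)), ?_, ?_⟩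
  · rw [card_image_of_injective _ Nat.cast_injective, card_range]
  set S := (range n).image (fun i : ℕ => (i : ℝ)) with hS
  have hfloor : ∀ x : {x : ℝ // x ∈ S}, ((⌊x.1⌋₊ : ℕ) : ℝ) = x.1 := by
    rintro ⟨x, hx⟩
    obtain ⟨i, -, rfl⟩ := mem_image.1 hx
    simp
  let p : {x : ℝ // x ∈ S} → ℕ := fun x => ⌊x.1⌋₊
  have hp : Function.Injective p := by
    intro x y hxy
    apply Subtype.ext
    rw [← hfloor x, ← hfloor y]
    exact congrArg Nat.cast hxy
  have hd : ∀ x y : {x : ℝ // x ∈ S}, dist x y = |(p x : ℝ) - p y| := by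
    intro x y
    rw [Subtype.dist_eq, Real.dist_eq, hfloor, hfloor]
  have hsurj : ∀ i < n, ∃ x, p x = i := fun i hi =>
    ⟨⟨(i : ℝ), mem_image_of_mem _ (mem_range.2 hi)⟩, Nat.floor_natCast i⟩
  have hcard : Fintype.card {x : ℝ // x ∈ S} = n := by
    rw [Fintype.card_coe, hS, card_image_of_injective _ Nat.cast_injective, card_range]
  refine ⟨segmentExec n hcard (by omega) hp hd hsurj, ?_⟩
  change _ ≤ maxAvg dist (segmentClustering p (n + 1 - k)) /
    sepMin dist (segmentClustering p (n + 1 - k))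
  obtain ⟨o, ho⟩ := hsurj 0 (by omega)
  obtain ⟨y, hy⟩ := hsurj (n + 1 - k) (by omega)
  obtain ⟨z, hz⟩ := hsurj (n + 1 - k + 1) (by omega)
  have hsurj' : ∀ i < n + 1 - k, ∃ x, p x = i := fun i hi => hsurj i (by omega)
  rw [sepMin_segmentClustering hp hd (o := o) (by omega) hy hz, div_one]
  refine le_trans ?_ (le_maxAvg (mem_segmentClustering.2 (Or.inl rfl)) ?_)
  · rw [avgS_initialSegment hp hd (by omega) hsurj', Nat.cast_sub (by omega)]
    push_cast
    linarith
  · rw [card_initialSegment hp hsurj']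
    omega
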